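/- Let 𝒳 be a fuzzy random number with 𝒳 ∈ L¹. Then Med(𝒳;D_1) = Med(𝒳;D_FT): a fuzzy number maximizes the L¹-type depth D_1(A;𝒳) := (1 + E[ρ_1(A,𝒳)])⁻¹ over F_c(ℝ) if and only if it maximizes the fuzzy Tukey depth D_FT(·;𝒳) over F_c(ℝ). -/

import Mathlib

open MeasureTheory Set ENNReal

noncomputable section

/-- The α-levels of a membership function `A : ℝ → [0,1]`. -/
def fuzzyLevel (A : ℝ → ℝ) (α : ℝ) : Set ℝ :=
  if α = 0 then closure {x | 0 < A x} else {x | α ≤ A x}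

/-- A fuzzy number: a function `ℝ → [0,1]` all of whose α-levels (α ∈ [0,1])
are nonempty compact convex subsets of ℝ. -/
structure FuzzyNumber where
  mem : ℝ → ℝ
  mem_range : ∀ x, mem x ∈ Set.Icc (0:ℝ) 1
  level_nonempty : ∀ α ∈ Set.Icc (0:ℝ) 1, (fuzzyLevel mem α).Nonempty
  level_compact : ∀ α ∈ Set.Icc (0:ℝ) 1, IsCompact (fuzzyLevel mem α)
  level_convex : ∀ α ∈ Set.Icc (0:ℝ) 1, Convex ℝ (fuzzyLevel mem α)

/-- Support function of a fuzzy number. -/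
def suppFn (A : FuzzyNumber) (u α : ℝ) : ℝ :=
  sSup ((fun v => u * v) '' fuzzyLevel A.mem α)

/-- Set of medians of a real random variable. -/
def MedSet {Ω : Type*} [MeasurableSpace Ω] (P : Measure Ω) (Y : Ω → ℝ) : Set ℝ :=
  {m : ℝ | 1/2 ≤ P {ω | Y ω ≤ m} ∧ 1/2 ≤ P {ω | m ≤ Y ω}}

/-- A fuzzy number is a support median of a fuzzy random number. -/
def IsSupportMedian {Ω : Type*} [MeasurableSpace Ω] (P : Measure Ω)
    (𝒳 : Ω → FuzzyNumber) (A : FuzzyNumber) : Prop :=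
  ∀ u ∈ ({-1, 1} : Set ℝ), ∀ α ∈ Set.Icc (0:ℝ) 1,
    suppFn A u α ∈ MedSet P (fun ω => suppFn (𝒳 ω) u α)

/-- Measurability of each real random variable `s_𝒳(u,α)`. -/
def SuppMeasurable {Ω : Type*} [MeasurableSpace Ω] (𝒳 : Ω → FuzzyNumber) : Prop :=
  ∀ u ∈ ({-1, 1} : Set ℝ), ∀ α ∈ Set.Icc (0:ℝ) 1,
    Measurable fun ω => suppFn (𝒳 ω) u α

/-- Joint measurability of `(u,α,ω) ↦ s_{𝒳(ω)}(u,α)` on {−1,1}×[0,1]×Ω. -/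
def JointlyMeasurable {Ω : Type*} [MeasurableSpace Ω] (𝒳 : Ω → FuzzyNumber) : Prop :=
  Measurable fun q : ({-1, 1} : Set ℝ) × (Set.Icc (0:ℝ) 1) × Ω =>
    suppFn (𝒳 q.2.2) (q.1 : ℝ) (q.2.1 : ℝ)

/-- The ρ₁ metric between fuzzy numbers. -/
def rho1 (A B : FuzzyNumber) : ℝ :=
  (1/2) * ∫ α in (0:ℝ)..1,
    (|suppFn A 1 α - suppFn B 1 α| + |suppFn A (-1) α - suppFn B (-1) α|)

/-- `𝒳 ∈ L¹`: the random variable `sup_{x ∈ 𝒳₀} |x|` is integrable. -/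
def FuzzyL1 {Ω : Type*} [MeasurableSpace Ω] (P : Measure Ω) (𝒳 : Ω → FuzzyNumber) : Prop :=
  Integrable (fun ω => sSup ((fun x => |x|) '' fuzzyLevel (𝒳 ω).mem 0)) P

/-- Fuzzy Tukey depth. -/
def DFT {Ω : Type*} [MeasurableSpace Ω] (P : Measure Ω) (𝒳 : Ω → FuzzyNumber)
    (A : FuzzyNumber) : ℝ≥0∞ :=
  ⨅ u ∈ ({-1, 1} : Set ℝ), ⨅ α ∈ Set.Icc (0:ℝ) 1,
    min (P {ω | suppFn (𝒳 ω) u α ≤ suppFn A u α})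
        (P {ω | suppFn A u α ≤ suppFn (𝒳 ω) u α})

/-- Midpoint median of a real random variable. -/
def medMid {Ω : Type*} [MeasurableSpace Ω] (P : Measure Ω) (Y : Ω → ℝ) : ℝ :=
  (sInf (MedSet P Y) + sSup (MedSet P Y)) / 2

/-- Median absolute deviation. -/
def MAD {Ω : Type*} [MeasurableSpace Ω] (P : Measure Ω) (Y : Ω → ℝ) : ℝ :=
  medMid P (fun ω => |Y ω - medMid P Y|)

/-- Outlyingness function. -/
def outly {Ω : Type*} [MeasurableSpace Ω] (P : Measure Ω) (𝒳 : Ω → FuzzyNumber)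
    (A : FuzzyNumber) : ℝ :=
  sSup {r : ℝ | ∃ u ∈ ({-1, 1} : Set ℝ), ∃ α ∈ Set.Icc (0:ℝ) 1,
    r = |suppFn A u α - medMid P (fun ω => suppFn (𝒳 ω) u α)| /
        MAD P (fun ω => suppFn (𝒳 ω) u α)}

/-- Fuzzy projection depth. -/
def DFP {Ω : Type*} [MeasurableSpace Ω] (P : Measure Ω) (𝒳 : Ω → FuzzyNumber)
    (A : FuzzyNumber) : ℝ :=
  (1 + outly P 𝒳 A)⁻¹

/-- Uniform probability on {−1,1} (as a measure on ℝ). -/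
def coinMeasure : Measure ℝ := (2:ℝ≥0∞)⁻¹ • (Measure.dirac (-1) + Measure.dirac 1)

/-- υ ⊗ ν on {−1,1} × [0,1]. -/
def baseMeasure : Measure (ℝ × ℝ) := coinMeasure.prod (volume.restrict (Set.Icc (0:ℝ) 1))

/-- Modified simplicial depth (p = 1, two independent copies). -/
def DmS {Ω : Type*} [MeasurableSpace Ω] (P : Measure Ω) (𝒳 : Ω → FuzzyNumber)
    (A : FuzzyNumber) : ℝ :=
  ∫ ω : Ω × Ω,
    (baseMeasure {p : ℝ × ℝ |
      min (suppFn (𝒳 ω.1) p.1 p.2) (suppFn (𝒳 ω.2) p.1 p.2) ≤ suppFn A p.1 p.2 ∧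
      suppFn A p.1 p.2 ≤ max (suppFn (𝒳 ω.1) p.1 p.2) (suppFn (𝒳 ω.2) p.1 p.2)}).toReal
    ∂(P.prod P)

/-- Fuzzy simplicial depth (p = 1). -/
def DFS {Ω : Type*} [MeasurableSpace Ω] (P : Measure Ω) (𝒳 : Ω → FuzzyNumber)
    (A : FuzzyNumber) : ℝ :=
  min
    (∫ ω : Ω × Ω,
      (volume {α ∈ Set.Icc (0:ℝ) 1 |
        min (suppFn (𝒳 ω.1) 1 α) (suppFn (𝒳 ω.2) 1 α) ≤ suppFn A 1 α ∧
        suppFn A 1 α ≤ max (suppFn (𝒳 ω.1) 1 α) (suppFn (𝒳 ω.2) 1 α)}).toReal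
      ∂(P.prod P))
    (∫ ω : Ω × Ω,
      (volume {α ∈ Set.Icc (0:ℝ) 1 |
        min (suppFn (𝒳 ω.1) (-1) α) (suppFn (𝒳 ω.2) (-1) α) ≤ suppFn A (-1) α ∧
        suppFn A (-1) α ≤ max (suppFn (𝒳 ω.1) (-1) α) (suppFn (𝒳 ω.2) (-1) α)}).toReal
      ∂(P.prod P))

/-- The L¹-type depth `D₁(A;𝒳) := (1 + E[ρ₁(A,𝒳)])⁻¹`. -/
def D1 {Ω : Type*} [MeasurableSpace Ω] (P : Measure Ω) (𝒳 : Ω → FuzzyNumber)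
    (A : FuzzyNumber) : ℝ :=
  (1 + ∫ ω, rho1 A (𝒳 ω) ∂P)⁻¹

theorem fuzzyLevel_subset {f : ℝ → ℝ} {α β : ℝ} (hβ : 0 ≤ β) (h : β ≤ α) :
    fuzzyLevel f α ⊆ fuzzyLevel f β := by
  rcases h.eq_or_lt with rfl | h
  · exact subset_rfl
  have hα : α ≠ 0 := (hβ.trans_lt h).ne'
  intro x hx
  simp only [fuzzyLevel, hα, if_false, mem_ofPred_eq] at hx
  by_cases h0 : β = 0
  · simp only [fuzzyLevel, h0, if_true]
    exact subset_closure (show 0 < f x from by linarith)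
  · simp only [fuzzyLevel, h0, if_false, mem_ofPred_eq]
    linarith

namespace FuzzyNumber

variable (A : FuzzyNumber) {u α β : ℝ}

theorem isGreatest_suppFn (u : ℝ) (hα : α ∈ Icc (0:ℝ) 1) :
    IsGreatest ((fun v => u * v) '' fuzzyLevel A.mem α) (suppFn A u α) :=
  ((A.level_compact α hα).image (by fun_prop)).isGreatest_sSup
    ((A.level_nonempty α hα).image _)

theorem suppFn_le_suppFn (u : ℝ) (hβ : 0 ≤ β) (h : β ≤ α) (hα : α ≤ 1) :
    suppFn A u α ≤ suppFn A u β :=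
  (A.isGreatest_suppFn u ⟨hβ, h.trans hα⟩).2
    (image_mono (fuzzyLevel_subset hβ h) (A.isGreatest_suppFn u ⟨hβ.trans h, hα⟩).1)

theorem neg_suppFn_neg_one_le (hα : α ∈ Icc (0:ℝ) 1) : -suppFn A 1 α ≤ suppFn A (-1) α := by
  obtain ⟨v, hv⟩ := A.level_nonempty α hα
  have h1 := (A.isGreatest_suppFn 1 hα).2 ⟨v, hv, rfl⟩
  have h2 := (A.isGreatest_suppFn (-1) hα).2 ⟨v, hv, rfl⟩
  simp only at h1 h2
  linarith

theorem mul_mem_fuzzyLevel (hu : u ∈ ({-1, 1} : Set ℝ)) (hα : α ∈ Icc (0:ℝ) 1) {x v : ℝ}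
    (hv : v ∈ fuzzyLevel A.mem α) (hvx : u * v ≤ x) (hx : x ≤ suppFn A u α) :
    u * x ∈ fuzzyLevel A.mem α := by
  obtain ⟨w, hw, hwu⟩ := (A.isGreatest_suppFn u hα).1
  have hc := (A.level_convex α hα).ordConnected
  simp only at hwu
  rcases hu with rfl | rfl
  · exact hc.out hw hv ⟨by linarith, by linarith⟩
  · exact hc.out hv hw ⟨by linarith, by linarith⟩

theorem abs_suppFn_le (hu : u ∈ ({-1, 1} : Set ℝ)) (hα : α ∈ Icc (0:ℝ) 1) :
    |suppFn A u α| ≤ sSup ((fun x => |x|) '' fuzzyLevel A.mem 0) := by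
  obtain ⟨w, hw, hwu⟩ := (A.isGreatest_suppFn u hα).1
  have h : |suppFn A u α| = |w| := by
    rw [← hwu]
    rcases hu with rfl | rfl <;> simp
  rw [h]
  exact le_csSup ((A.level_compact 0 (by simp)).image continuous_abs).bddAbove
    ⟨w, fuzzyLevel_subset le_rfl hα.1 hw, rfl⟩

theorem exists_suppFn_lt (hu : u ∈ ({-1, 1} : Set ℝ)) (hα0 : 0 < α) (hα1 : α ≤ 1) {c : ℝ}
    (hc : suppFn A u α < c) : ∃ β ∈ Ioo 0 α, suppFn A u β < c := by
  by_contra! H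
  have huu : u * u = 1 := by rcases hu with rfl | rfl <;> norm_num
  obtain ⟨v, hv, hvu⟩ := (A.isGreatest_suppFn u ⟨hα0.le, hα1⟩).1
  simp only at hvu
  have hle : ∀ β ∈ Ioo 0 α, β ≤ A.mem (u * c) := by
    intro β hβ
    have := A.mul_mem_fuzzyLevel hu ⟨hβ.1.le, hβ.2.le.trans hα1⟩
      (fuzzyLevel_subset hβ.1.le hβ.2.le hv) (by linarith) (H β hβ)
    simpa [fuzzyLevel, hβ.1.ne'] using this
  have hmem : u * c ∈ fuzzyLevel A.mem α := by
    simp only [fuzzyLevel, hα0.ne', if_false, mem_ofPred_eq]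
    refine le_of_forall_lt_imp_le_of_dense fun b hb => ?_
    exact (le_max_left b (α / 2)).trans (hle _ ⟨by positivity, max_lt hb (by linarith)⟩)
  have := (A.isGreatest_suppFn u ⟨hα0.le, hα1⟩).2 ⟨_, hmem, rfl⟩
  simp only [← mul_assoc, huu] at this
  linarith

theorem exists_lt_suppFn {c : ℝ} (hc : c < suppFn A u 0) :
    ∃ β > 0, β ≤ 1 ∧ c < suppFn A u β := by
  obtain ⟨v, hv, hvu⟩ := (A.isGreatest_suppFn u (α := 0) (by simp)).1
  simp only at hvu
  simp only [fuzzyLevel, if_true] at hv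
  obtain ⟨w, hwc, hw⟩ := mem_closure_iff.1 hv {x | c < u * x}
    (isOpen_lt continuous_const (by fun_prop)) (by simpa [hvu] using hc)
  have hw : 0 < A.mem w := hw
  have hw1 := (A.mem_range w).2
  refine ⟨A.mem w, hw, hw1, lt_of_lt_of_le hwc ?_⟩
  refine (A.isGreatest_suppFn u ⟨hw.le, hw1⟩).2 ⟨w, ?_, rfl⟩
  simp [fuzzyLevel, hw.ne']

theorem tendsto_suppFn (hu : u ∈ ({-1, 1} : Set ℝ)) (hα : α ∈ Icc (0:ℝ) 1) {a : ℕ → ℝ}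
    (ha : Filter.Tendsto a Filter.atTop (nhds α)) (ha01 : ∀ n, a n ∈ Icc (0:ℝ) 1)
    (haα : 0 < α → ∀ n, a n ≤ α) :
    Filter.Tendsto (fun n => suppFn A u (a n)) Filter.atTop (nhds (suppFn A u α)) := by
  rcases hα.1.eq_or_lt with rfl | h0
  · refine tendsto_order.2 ⟨fun c hc => ?_, fun c hc => .of_forall fun n => ?_⟩
    · obtain ⟨β, hβ, hβ1, hcβ⟩ := A.exists_lt_suppFn hc
      filter_upwards [ha.eventually (gt_mem_nhds hβ)] with n hn
      exact hcβ.trans_le (A.suppFn_le_suppFn u (ha01 n).1 hn.le hβ1)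
    · exact (A.suppFn_le_suppFn u le_rfl (ha01 n).1 (ha01 n).2).trans_lt hc
  · refine tendsto_order.2 ⟨fun c hc => .of_forall fun n => ?_, fun c hc => ?_⟩
    · exact hc.trans_le (A.suppFn_le_suppFn u (ha01 n).1 (haα h0 n) hα.2)
    · obtain ⟨β, hβ, hcβ⟩ := A.exists_suppFn_lt hu h0 hα.2 hc
      filter_upwards [ha.eventually (lt_mem_nhds hβ.2)] with n hn
      exact (A.suppFn_le_suppFn u hβ.1.le hn.le (ha01 n).2).trans_lt hcβ

end FuzzyNumber

/-- A pair of antitone left-continuous functions `f`, `g` on `(0,1]` with `-g ≤ f` gives the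
endpoints of the levels of a fuzzy number. -/
theorem exists_fuzzyNumber_suppFn_eq {f g : ℝ → ℝ}
    (hf : AntitoneOn f (Icc 0 1)) (hg : AntitoneOn g (Icc 0 1))
    (hfg : ∀ α ∈ Icc (0:ℝ) 1, -f α ≤ g α)
    (hf' : ∀ α ∈ Ioc (0:ℝ) 1, ∀ x, (∀ β ∈ Ioo 0 α, x ≤ f β) → x ≤ f α)
    (hg' : ∀ α ∈ Ioc (0:ℝ) 1, ∀ x, (∀ β ∈ Ioo 0 α, x ≤ g β) → x ≤ g α) :
    ∃ A : FuzzyNumber, ∀ α ∈ Ioc (0:ℝ) 1, suppFn A 1 α = f α ∧ suppFn A (-1) α = g α := by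
  let S : ℝ → Set ℝ := fun x => {α | α ∈ Ioc (0:ℝ) 1 ∧ x ≤ f α ∧ -x ≤ g α}
  let μ : ℝ → ℝ := fun x => sSup (S x)
  have hbdd : ∀ x, BddAbove (S x) := fun x => ⟨1, fun α h => h.1.2⟩
  have hanti : ∀ {x α β}, α ∈ S x → 0 < β → β ≤ α → β ∈ S x := by
    intro x α β h h0 hle
    have hβ : β ∈ Icc (0:ℝ) 1 := ⟨h0.le, hle.trans h.1.2⟩
    exact ⟨⟨h0, hβ.2⟩, h.2.1.trans (hf hβ ⟨h.1.1.le, h.1.2⟩ hle),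
      h.2.2.trans (hg hβ ⟨h.1.1.le, h.1.2⟩ hle)⟩
  have hlt : ∀ {x β}, 0 < β → β < μ x → β ∈ S x := by
    intro x β h0 h
    have hne : (S x).Nonempty := by
      by_contra hne
      have : μ x = 0 := by simp [μ, not_nonempty_iff_eq_empty.1 hne]
      linarith
    obtain ⟨γ, hγ, hβγ⟩ := exists_lt_of_lt_csSup hne h
    exact hanti hγ h0 hβγ.le
  have hle : ∀ x, ∀ α ∈ Ioc (0:ℝ) 1, α ≤ μ x ↔ x ∈ Icc (-g α) (f α) := by
    intro x α hα
    constructor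
    · intro h
      have hS : ∀ β ∈ Ioo 0 α, β ∈ S x := fun β hβ => hlt hβ.1 (hβ.2.trans_le h)
      exact ⟨neg_le.1 (hg' α hα (-x) fun β hβ => (hS β hβ).2.2),
        hf' α hα x fun β hβ => (hS β hβ).2.1⟩
    · intro h
      exact le_csSup (hbdd x) ⟨hα, h.2, neg_le.1 h.1⟩
  have hlevel : ∀ α ∈ Ioc (0:ℝ) 1, fuzzyLevel μ α = Icc (-g α) (f α) := by
    intro α hα
    ext x
    simpa [fuzzyLevel, hα.1.ne'] using hle x α hα
  have hnonneg : ∀ x, 0 ≤ μ x := fun x => Real.sSup_nonneg fun α h => h.1.1.le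
  have hone : ∀ x, μ x ≤ 1 := fun x => Real.sSup_le (fun α h => h.1.2) zero_le_one
  have hpos : ∀ x, 0 < μ x → ∃ α ∈ Ioc (0:ℝ) 1, x ∈ Icc (-g α) (f α) := fun x hx =>
    ⟨μ x, ⟨hx, hone x⟩, (hle x _ ⟨hx, hone x⟩).1 le_rfl⟩
  have hlevel0 : fuzzyLevel μ 0 = closure {x | 0 < μ x} := by simp [fuzzyLevel]
  have hcases : ∀ α ∈ Icc (0:ℝ) 1, α = 0 ∨ α ∈ Ioc (0:ℝ) 1 := fun α hα =>
    hα.1.eq_or_lt.imp Eq.symm fun h => ⟨h, hα.2⟩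
  let A : FuzzyNumber :=
    { mem := μ
      mem_range := fun x => ⟨hnonneg x, hone x⟩
      level_nonempty := by
        have h1 : (1:ℝ) ∈ Ioc (0:ℝ) 1 := by simp
        intro α hα
        refine Set.Nonempty.mono (fuzzyLevel_subset hα.1 hα.2) ?_
        rw [hlevel 1 h1]
        exact nonempty_Icc.2 (neg_le.1 (hfg 1 (by simp)))
      level_compact := by
        intro α hα
        rcases hcases α hα with rfl | hα
        · rw [hlevel0]
          refine (isCompact_Icc (a := -g 0) (b := f 0)).of_isClosed_subset isClosed_closure
            (closure_minimal (fun x hx => ?_) isClosed_Icc)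
          obtain ⟨α, hα, hx⟩ := hpos x hx
          have hα' : α ∈ Icc (0:ℝ) 1 := ⟨hα.1.le, hα.2⟩
          exact ⟨(neg_le_neg (hg (by simp) hα' hα'.1)).trans hx.1,
            hx.2.trans (hf (by simp) hα' hα'.1)⟩
        · rw [hlevel α hα]
          exact isCompact_Icc
      level_convex := by
        intro α hα
        rcases hcases α hα with rfl | hα
        · rw [hlevel0]
          refine (OrdConnected.convex ⟨fun x hx y hy z hz => ?_⟩).closure
          have hm : min (μ x) (μ y) ∈ Ioc (0:ℝ) 1 :=
            ⟨lt_min hx hy, (min_le_left _ _).trans (hone x)⟩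
          exact hm.1.trans_le ((hle z _ hm).2
            ⟨((hle x _ hm).1 (min_le_left _ _)).1.trans hz.1,
              hz.2.trans ((hle y _ hm).1 (min_le_right _ _)).2⟩)
        · rw [hlevel α hα]
          exact convex_Icc _ _ }
  refine ⟨A, fun α hα => ?_⟩
  have hα' : α ∈ Icc (0:ℝ) 1 := ⟨hα.1.le, hα.2⟩
  have hne : -g α ≤ f α := neg_le.1 (hfg α hα')
  have hA : fuzzyLevel A.mem α = Icc (-g α) (f α) := hlevel α hα
  constructor
  · simp only [suppFn, hA, one_mul, image_id']
    exact csSup_Icc hne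
  · simp [suppFn, hA, csSup_Icc, neg_le.1 hne]

/-! ### Medians of real random variables -/

section Median

variable {Ω : Type*} [MeasurableSpace Ω] {P : Measure Ω}

theorem half_le_measure_nonneg_of_tendsto [IsFiniteMeasure P] {Z : ℕ → Ω → ℝ} {W : Ω → ℝ}
    (hZ : ∀ n, Measurable (Z n)) (h : ∀ n, 1/2 ≤ P {ω | 0 ≤ Z n ω})
    (hlim : ∀ ω, Filter.Tendsto (fun n => Z n ω) Filter.atTop (nhds (W ω))) :
    1/2 ≤ P {ω | 0 ≤ W ω} := by
  let E : ℕ → Set Ω := fun N => ⋃ n ≥ N, {ω | 0 ≤ Z n ω}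
  have hE : Antitone E := fun M N hMN => biUnion_subset_biUnion_left fun n hn => hMN.trans hn
  have hmeas : ∀ N, MeasurableSet (E N) := fun N =>
    .iUnion fun n => .iUnion fun _ => measurableSet_le measurable_const (hZ n)
  have htend := tendsto_measure_iInter_atTop (μ := P) (fun N => (hmeas N).nullMeasurableSet) hE
    ⟨0, measure_ne_top _ _⟩
  refine (ge_of_tendsto' htend fun N => (h N).trans (measure_mono ?_)).trans (measure_mono ?_)
  · exact subset_biUnion_of_mem (u := fun n => {ω | 0 ≤ Z n ω}) (le_refl N)
  · intro ω hω
    refine ge_of_tendsto_of_frequently (hlim ω) (Filter.frequently_atTop.2 fun N => ?_)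
    have := mem_iInter.1 hω N
    simpa [E] using this

theorem mem_medSet_of_tendsto [IsFiniteMeasure P] {Y : ℕ → Ω → ℝ} {Y' : Ω → ℝ} {m : ℕ → ℝ}
    {m' : ℝ} (hY : ∀ n, Measurable (Y n)) (h : ∀ n, m n ∈ MedSet P (Y n))
    (hlim : ∀ ω, Filter.Tendsto (fun n => Y n ω) Filter.atTop (nhds (Y' ω)))
    (hm : Filter.Tendsto m Filter.atTop (nhds m')) : m' ∈ MedSet P Y' := by
  constructor
  · have := half_le_measure_nonneg_of_tendsto (P := P) (Z := fun n ω => m n - Y n ω)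
      (fun n => (hY n).const_sub _) (fun n => by simpa using (h n).1)
      (fun ω => hm.sub (hlim ω))
    simpa using this
  · have := half_le_measure_nonneg_of_tendsto (P := P) (Z := fun n ω => Y n ω - m n)
      (fun n => (hY n).sub_const _) (fun n => by simpa using (h n).2)
      (fun ω => (hlim ω).sub hm)
    simpa using this

theorem neg_mem_medSet {Y : Ω → ℝ} {m : ℝ} (hm : m ∈ MedSet P Y) : -m ∈ MedSet P (fun ω => -Y ω) := by
  simpa [MedSet, and_comm] using hm

/-- The largest median of a real random variable. -/
def upperMedian (P : Measure Ω) (Y : Ω → ℝ) : ℝ := sSup {m | 1/2 ≤ P {ω | m ≤ Y ω}}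

variable [IsProbabilityMeasure P] {Y Y' : Ω → ℝ}

theorem measure_lt_half_or (hY : Measurable Y) (m : ℝ) :
    1/2 ≤ P {ω | m ≤ Y ω} ∨ 1/2 ≤ P {ω | Y ω < m} := by
  by_contra! H
  have h : P {ω | m ≤ Y ω} + P {ω | m ≤ Y ω}ᶜ = 1 :=
    prob_add_prob_compl (measurableSet_le measurable_const hY)
  have hc : {ω | m ≤ Y ω}ᶜ = {ω | Y ω < m} := by ext; simp
  rw [hc] at h
  have := ENNReal.add_lt_add H.1 H.2
  rw [h, ENNReal.add_halves] at this
  exact lt_irrefl _ this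

theorem exists_half_le_measure_le (hY : Measurable Y) : ∃ m, 1/2 ≤ P {ω | m ≤ Y ω} := by
  by_contra! H
  have h : ∀ n : ℕ, 1/2 ≤ P {ω | Y ω < -(n:ℝ)} := fun n =>
    (measure_lt_half_or hY _).resolve_left (H _).not_ge
  have hanti : Antitone fun n : ℕ => {ω | Y ω < -(n:ℝ)} := by
    intro a b hab ω hω
    have : (a:ℝ) ≤ b := by exact_mod_cast hab
    simp only [mem_ofPred_eq] at hω ⊢
    linarith
  have ht := tendsto_measure_iInter_atTop (μ := P)
    (fun n => (measurableSet_lt hY measurable_const).nullMeasurableSet) hanti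
    ⟨0, measure_ne_top _ _⟩
  have h0 : (⋂ n : ℕ, {ω | Y ω < -(n:ℝ)}) = ∅ := by
    ext ω
    obtain ⟨n, hn⟩ := exists_nat_gt (-Y ω)
    simp only [mem_iInter, mem_ofPred_eq, mem_empty_iff_false, iff_false, not_forall, not_lt]
    exact ⟨n, by linarith⟩
  have := ge_of_tendsto' ht h
  simp [h0] at this

theorem bddAbove_half_le_measure_le (hY : Measurable Y) :
    BddAbove {m | 1/2 ≤ P {ω | m ≤ Y ω}} := by
  by_contra H
  rw [not_bddAbove_iff] at H
  have h : ∀ n : ℕ, 1/2 ≤ P {ω | (n:ℝ) ≤ Y ω} := fun n => by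
    obtain ⟨m, hm, hnm⟩ := H n
    exact le_trans hm (measure_mono fun ω hω => hnm.le.trans hω)
  have hanti : Antitone fun n : ℕ => {ω | (n:ℝ) ≤ Y ω} := by
    intro a b hab ω hω
    have : (a:ℝ) ≤ b := by exact_mod_cast hab
    exact this.trans hω
  have ht := tendsto_measure_iInter_atTop (μ := P)
    (fun n => (measurableSet_le measurable_const hY).nullMeasurableSet) hanti
    ⟨0, measure_ne_top _ _⟩
  have h0 : (⋂ n : ℕ, {ω | (n:ℝ) ≤ Y ω}) = ∅ := by
    ext ω
    obtain ⟨n, hn⟩ := exists_nat_gt (Y ω)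
    simp only [mem_iInter, mem_ofPred_eq, mem_empty_iff_false, iff_false, not_forall, not_le]
    exact ⟨n, hn⟩
  have := ge_of_tendsto' ht h
  simp [h0] at this

theorem le_upperMedian_iff (hY : Measurable Y) {m : ℝ} :
    m ≤ upperMedian P Y ↔ 1/2 ≤ P {ω | m ≤ Y ω} := by
  refine ⟨fun h => ?_, fun h => le_csSup (bddAbove_half_le_measure_le hY) h⟩
  obtain ⟨a, -, ha, haS⟩ := exists_seq_tendsto_sSup (exists_half_le_measure_le (P := P) hY)
    (bddAbove_half_le_measure_le hY)
  have h2 : 1/2 ≤ P {ω | 0 ≤ Y ω - upperMedian P Y} :=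
    half_le_measure_nonneg_of_tendsto (Z := fun n ω => Y ω - a n) (fun n => hY.sub_const _)
      (fun n => by simpa using show 1/2 ≤ P {ω | a n ≤ Y ω} from haS n)
      (fun ω => tendsto_const_nhds.sub ha)
  refine h2.trans (measure_mono fun ω hω => ?_)
  simp only [mem_ofPred_eq] at hω ⊢
  linarith

theorem upperMedian_mem_medSet (hY : Measurable Y) : upperMedian P Y ∈ MedSet P Y := by
  refine ⟨?_, (le_upperMedian_iff hY).1 le_rfl⟩
  have ha : Filter.Tendsto (fun n : ℕ => upperMedian P Y + 1 / ((n:ℝ) + 1)) Filter.atTop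
      (nhds (upperMedian P Y + 0)) := tendsto_const_nhds.add tendsto_one_div_add_atTop_nhds_zero_nat
  have := half_le_measure_nonneg_of_tendsto (P := P)
    (Z := fun (n : ℕ) ω => (upperMedian P Y + 1 / ((n:ℝ) + 1)) - Y ω)
    (fun n => hY.const_sub _) (fun n => ?_) (fun ω => ha.sub_const _)
  · simpa using this
  · have hpos : (0:ℝ) < 1 / ((n:ℝ) + 1) := by positivity
    have h := (measure_lt_half_or (P := P) hY (upperMedian P Y + 1 / ((n:ℝ) + 1))).resolve_left
      fun h => by linarith [(le_upperMedian_iff hY).2 h]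
    refine h.trans (measure_mono fun ω hω => ?_)
    simp only [mem_ofPred_eq] at hω ⊢
    linarith

theorem upperMedian_mono (hY : Measurable Y) (hY' : Measurable Y') (h : ∀ ω, Y ω ≤ Y' ω) :
    upperMedian P Y ≤ upperMedian P Y' :=
  (le_upperMedian_iff hY').2 <| ((le_upperMedian_iff hY).1 le_rfl).trans <|
    measure_mono fun ω hω => le_trans hω (h ω)

theorem neg_upperMedian_le (hY : Measurable Y) (hY' : Measurable Y') (h : ∀ ω, -Y ω ≤ Y' ω) :
    -upperMedian P Y ≤ upperMedian P Y' := by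
  refine (le_upperMedian_iff hY').2 ((upperMedian_mem_medSet hY).1.trans (measure_mono ?_))
  intro ω hω
  exact (neg_le_neg hω).trans (h ω)

/-- A point different from some median has Tukey depth at most one half. -/
theorem min_measure_le_half_of_mem_medSet_of_ne (hY : Measurable Y) {m m' : ℝ}
    (hm' : m' ∈ MedSet P Y) (hne : m ≠ m') :
    min (P {ω | Y ω ≤ m}) (P {ω | m ≤ Y ω}) ≤ 1/2 := by
  have key : ∀ {E F : Set Ω}, MeasurableSet E → Disjoint E F → 1/2 ≤ P F → P E ≤ 1/2 := by
    intro E F hE hEF hF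
    have h1 : P E + P F ≤ 1/2 + 1/2 := by
      rw [ENNReal.add_halves, ← measure_union' hEF hE]
      exact prob_le_one
    by_contra! h
    exact absurd h1 (ENNReal.add_lt_add_of_lt_of_le (by simp) h hF).not_ge
  rcases hne.lt_or_gt with h | h
  · refine (min_le_left _ _).trans (key (measurableSet_le hY measurable_const) ?_ hm'.2)
    exact disjoint_left.2 fun ω h1 h2 => absurd (h2.trans h1) h.not_ge
  · refine (min_le_right _ _).trans (key (measurableSet_le measurable_const hY) ?_ hm'.1)
    exact disjoint_left.2 fun ω h1 h2 => absurd (le_trans h1 h2) h.not_ge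

theorem integral_abs_sub_le_of_mem_medSet_of_lt (hY : Measurable Y) (hYi : Integrable Y P) {m c : ℝ}
    (hm : m ∈ MedSet P Y) (hmc : m < c) :
    ∫ ω, |m - Y ω| ∂P ≤ ∫ ω, |c - Y ω| ∂P ∧
      (∫ ω, |c - Y ω| ∂P ≤ ∫ ω, |m - Y ω| ∂P → c ∈ MedSet P Y) := by
  have hS : MeasurableSet {ω | Y ω ≤ m} := measurableSet_le hY measurable_const
  have hi : ∀ x : ℝ, Integrable (fun ω => |x - Y ω|) P := fun x =>
    ((integrable_const x).sub hYi).abs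
  let φ : Ω → ℝ := fun ω => (c - m) * (2 * {ω | Y ω ≤ m}.indicator 1 ω - 1)
  have hDi : Integrable (fun ω => |c - Y ω| - |m - Y ω|) P := (hi c).sub (hi m)
  have hind : Integrable ({ω | Y ω ≤ m}.indicator (1 : Ω → ℝ)) P :=
    (integrable_const (1:ℝ)).indicator hS
  have hφi : Integrable φ P := ((hind.const_mul 2).sub (integrable_const 1)).const_mul _
  have hφ : ∫ ω, φ ω ∂P = (c - m) * (2 * P.real {ω | Y ω ≤ m} - 1) := by
    simp only [φ]
    rw [integral_const_mul, integral_sub (hind.const_mul 2) (integrable_const 1),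
      integral_const_mul, integral_indicator_one hS]
    simp
  have hle : ∀ ω, φ ω ≤ |c - Y ω| - |m - Y ω| := by
    intro ω
    by_cases h : Y ω ≤ m
    · simp only [φ, indicator_of_mem (show ω ∈ {ω | Y ω ≤ m} from h), Pi.one_apply]
      rw [abs_of_nonneg (by linarith), abs_of_nonneg (by linarith)]
      linarith
    · simp only [φ, indicator_of_notMem (show ω ∉ {ω | Y ω ≤ m} from h)]
      rw [abs_of_nonpos (by linarith : m - Y ω ≤ 0)]
      linarith [le_abs_self (c - Y ω), neg_abs_le (c - Y ω)]
  have hreal : 1/2 ≤ P.real {ω | Y ω ≤ m} := by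
    have := ENNReal.toReal_mono (measure_ne_top _ _) hm.1
    simpa [measureReal_def] using this
  have hD : ∫ ω, φ ω ∂P ≤ ∫ ω, |c - Y ω| ∂P - ∫ ω, |m - Y ω| ∂P := by
    rw [← integral_sub (hi c) (hi m)]
    exact integral_mono hφi hDi hle
  have hφ0 : 0 ≤ ∫ ω, φ ω ∂P := by
    rw [hφ]
    exact mul_nonneg (by linarith) (by linarith)
  refine ⟨by linarith, fun h => ?_⟩
  have hφz : ∫ ω, φ ω ∂P = 0 := by linarith
  have hae : ∀ᵐ ω ∂P, φ ω = |c - Y ω| - |m - Y ω| := by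
    have h0 : ∫ ω, (|c - Y ω| - |m - Y ω| - φ ω) ∂P = 0 := by
      rw [integral_sub hDi hφi, integral_sub (hi c) (hi m)]
      linarith
    have := (integral_eq_zero_iff_of_nonneg (fun ω => sub_nonneg.2 (hle ω))
      (hDi.sub hφi)).1 h0
    filter_upwards [this] with ω hω
    simp only [Pi.zero_apply] at hω
    linarith
  have hhalf : P.real {ω | Y ω ≤ m} = 1/2 := by
    rw [hφ] at hφz
    rcases mul_eq_zero.1 hφz with h | h <;> linarith
  have hcompl : P {ω | Y ω ≤ m}ᶜ = 1/2 := by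
    have h1 : P.real {ω | Y ω ≤ m}ᶜ = 1/2 := by
      rw [probReal_compl_eq_one_sub hS, hhalf]
      norm_num
    rw [← ENNReal.ofReal_toReal (measure_ne_top P _)]
    rw [measureReal_def] at h1
    rw [h1, ENNReal.ofReal_div_of_pos (by norm_num)]
    simp
  refine ⟨hm.1.trans (measure_mono fun ω hω => le_trans hω hmc.le), ?_⟩
  rw [← hcompl]
  refine measure_mono_ae ?_
  filter_upwards [hae] with ω hω hωm
  have h' : m < Y ω := not_le.1 hωm
  change c ≤ Y ω
  by_contra! hc
  simp only [φ, indicator_of_notMem hωm] at hω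
  rw [abs_of_pos (by linarith), abs_of_neg (by linarith)] at hω
  linarith

theorem integral_abs_sub_le_of_mem_medSet (hY : Measurable Y) (hYi : Integrable Y P) {m : ℝ}
    (hm : m ∈ MedSet P Y) (c : ℝ) :
    ∫ ω, |m - Y ω| ∂P ≤ ∫ ω, |c - Y ω| ∂P ∧
      (∫ ω, |c - Y ω| ∂P ≤ ∫ ω, |m - Y ω| ∂P → c ∈ MedSet P Y) := by
  rcases lt_trichotomy m c with h | rfl | h
  · exact integral_abs_sub_le_of_mem_medSet_of_lt hY hYi hm h
  · exact ⟨le_rfl, fun _ => hm⟩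
  · have := integral_abs_sub_le_of_mem_medSet_of_lt hY.neg hYi.neg (neg_mem_medSet hm) (neg_lt_neg h)
    have hab : ∀ x ω, |-x - (-Y) ω| = |x - Y ω| := fun x ω => by
      rw [← abs_neg]
      congr 1
      simp only [Pi.neg_apply]
      ring
    simp only [hab] at this
    exact ⟨this.1, fun hc => by simpa using neg_mem_medSet (this.2 hc)⟩

end Median

/-! ### Support medians and the two depths -/

section Depth

variable {Ω : Type*} [MeasurableSpace Ω] {P : Measure Ω}
  {𝒳 : Ω → FuzzyNumber} {A : FuzzyNumber}

theorem half_le_DFT_iff : 1/2 ≤ DFT P 𝒳 A ↔ IsSupportMedian P 𝒳 A := by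
  simp only [DFT, IsSupportMedian, MedSet, le_iInf_iff, le_min_iff, mem_ofPred_eq]

theorem integrable_suppFn (hmeas : SuppMeasurable 𝒳) (hL1 : FuzzyL1 P 𝒳) {u α : ℝ}
    (hu : u ∈ ({-1, 1} : Set ℝ)) (hα : α ∈ Icc (0:ℝ) 1) :
    Integrable (fun ω => suppFn (𝒳 ω) u α) P :=
  hL1.mono' (hmeas u hu α hα).aestronglyMeasurable
    (.of_forall fun ω => (𝒳 ω).abs_suppFn_le hu hα)

theorem D1_le_D1_iff {U : FuzzyNumber} :
    D1 P 𝒳 U ≤ D1 P 𝒳 A ↔ ∫ ω, rho1 A (𝒳 ω) ∂P ≤ ∫ ω, rho1 U (𝒳 ω) ∂P := by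
  have h : ∀ B : FuzzyNumber, 0 ≤ ∫ ω, rho1 B (𝒳 ω) ∂P := fun B =>
    integral_nonneg fun ω => mul_nonneg (by norm_num)
      (intervalIntegral.integral_nonneg zero_le_one fun α _ => by positivity)
  have hA := h A
  have hU := h U
  rw [D1, D1, inv_le_inv₀ (by positivity) (by positivity), add_le_add_iff_left]

variable [IsProbabilityMeasure P]

theorem isSupportMedian_of_ae (hmeas : SuppMeasurable 𝒳)
    (h : ∀ u ∈ ({-1, 1} : Set ℝ), ∀ᵐ α : ℝ, α ∈ Icc (0:ℝ) 1 →
      suppFn A u α ∈ MedSet P (fun ω => suppFn (𝒳 ω) u α)) :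
    IsSupportMedian P 𝒳 A := by
  intro u hu α hα
  obtain ⟨b, hb0, hb1, hαb, hb⟩ : ∃ b : ℝ, 0 < b ∧ b ≤ 1 ∧ α ∈ Icc 0 b ∧ (0 < α → b = α) := by
    rcases hα.1.eq_or_lt with h0 | h0
    · exact ⟨1, one_pos, le_rfl, hα, fun h => absurd h h0.not_lt⟩
    · exact ⟨α, h0, hα.2, ⟨hα.1, le_rfl⟩, fun _ => rfl⟩
  have hcl : α ∈ closure (Ioo 0 b ∩ {α | α ∈ Icc (0:ℝ) 1 →
      suppFn A u α ∈ MedSet P (fun ω => suppFn (𝒳 ω) u α)}) := by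
    have hd := Measure.dense_of_ae (h u hu)
    rw [← closure_Ioo hb0.ne] at hαb
    exact closure_minimal (hd.open_subset_closure_inter isOpen_Ioo) isClosed_closure hαb
  obtain ⟨a, ha, hlim⟩ := mem_closure_iff_seq_limit.1 hcl
  have ha01 : ∀ n, a n ∈ Icc (0:ℝ) 1 := fun n => ⟨(ha n).1.1.le, (ha n).1.2.le.trans hb1⟩
  have haα : 0 < α → ∀ n, a n ≤ α := fun h0 n => hb h0 ▸ (ha n).1.2.le
  exact mem_medSet_of_tendsto (fun n => hmeas u hu _ (ha01 n)) (fun n => (ha n).2 (ha01 n))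
    (fun ω => (𝒳 ω).tendsto_suppFn hu hα hlim ha01 haα) (A.tendsto_suppFn hu hα hlim ha01 haα)

theorem exists_isSupportMedian (hmeas : SuppMeasurable 𝒳) :
    ∃ B : FuzzyNumber, IsSupportMedian P 𝒳 B := by
  have h1 : (1:ℝ) ∈ ({-1, 1} : Set ℝ) := by simp
  have h2 : (-1:ℝ) ∈ ({-1, 1} : Set ℝ) := by simp
  let f : ℝ → ℝ → ℝ := fun u α => upperMedian P fun ω => suppFn (𝒳 ω) u α
  have hanti : ∀ u ∈ ({-1, 1} : Set ℝ), AntitoneOn (f u) (Icc 0 1) := fun u hu α hα β hβ h =>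
    upperMedian_mono (hmeas u hu β hβ) (hmeas u hu α hα)
      fun ω => (𝒳 ω).suppFn_le_suppFn u hα.1 h hβ.2
  have hleft : ∀ u ∈ ({-1, 1} : Set ℝ), ∀ α ∈ Ioc (0:ℝ) 1, ∀ x,
      (∀ β ∈ Ioo 0 α, x ≤ f u β) → x ≤ f u α := by
    intro u hu α hα x hx
    have hα' : α ∈ Icc (0:ℝ) 1 := ⟨hα.1.le, hα.2⟩
    obtain ⟨a, -, ha, hlim⟩ := exists_seq_strictMono_tendsto' hα.1
    have ha01 : ∀ n, a n ∈ Icc (0:ℝ) 1 := fun n => ⟨(ha n).1.le, (ha n).2.le.trans hα.2⟩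
    refine (le_upperMedian_iff (hmeas u hu α hα')).2 ?_
    have := half_le_measure_nonneg_of_tendsto (P := P)
      (Z := fun n ω => suppFn (𝒳 ω) u (a n) - x)
      (fun n => (hmeas u hu _ (ha01 n)).sub_const x)
      (fun n => by simpa using (le_upperMedian_iff (hmeas u hu _ (ha01 n))).1 (hx _ (ha n)))
      (fun ω => ((𝒳 ω).tendsto_suppFn hu hα' hlim ha01 fun _ n => (ha n).2.le).sub_const x)
    simpa using this
  obtain ⟨B, hB⟩ := exists_fuzzyNumber_suppFn_eq (hanti 1 h1) (hanti (-1) h2)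
    (fun α hα => neg_upperMedian_le (hmeas 1 h1 α hα) (hmeas (-1) h2 α hα)
      fun ω => (𝒳 ω).neg_suppFn_neg_one_le hα) (hleft 1 h1) (hleft (-1) h2)
  refine ⟨B, isSupportMedian_of_ae hmeas fun u hu => ?_⟩
  filter_upwards [Measure.ae_ne volume (0:ℝ)] with α h0 hα
  have hf : suppFn B u α = f u α := by
    have := hB α ⟨lt_of_le_of_ne hα.1 h0.symm, hα.2⟩
    rcases hu with rfl | rfl
    exacts [this.2, this.1]
  rw [hf]
  exact upperMedian_mem_medSet (hmeas u hu α hα)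

theorem forall_DFT_le_iff (hmeas : SuppMeasurable 𝒳) :
    (∀ U : FuzzyNumber, DFT P 𝒳 U ≤ DFT P 𝒳 A) ↔ IsSupportMedian P 𝒳 A := by
  constructor
  · intro h
    obtain ⟨B, hB⟩ := exists_isSupportMedian (P := P) hmeas
    exact half_le_DFT_iff.1 ((half_le_DFT_iff.2 hB).trans (h B))
  · intro hA U
    refine le_iInf₂ fun u hu => le_iInf₂ fun α hα => ?_
    have hU : DFT P 𝒳 U ≤ min (P {ω | suppFn (𝒳 ω) u α ≤ suppFn U u α})
        (P {ω | suppFn U u α ≤ suppFn (𝒳 ω) u α}) :=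
      (iInf₂_le u hu).trans (iInf₂_le α hα)
    by_cases hne : suppFn U u α = suppFn A u α
    · rwa [hne] at hU
    · exact (hU.trans (min_measure_le_half_of_mem_medSet_of_ne (hmeas u hu α hα)
        (hA u hu α hα) hne)).trans (le_min (hA u hu α hα).1 (hA u hu α hα).2)

theorem integrable_prod_abs_suppFn_sub (hjoint : JointlyMeasurable 𝒳) (hL1 : FuzzyL1 P 𝒳)
    (A : FuzzyNumber) {u : ℝ} (hu : u ∈ ({-1, 1} : Set ℝ)) :
    Integrable (fun p : Icc (0:ℝ) 1 × Ω => |suppFn A u p.1 - suppFn (𝒳 p.2) u p.1|)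
      ((volume : Measure (Icc (0:ℝ) 1)).prod P) := by
  have hA : Measurable fun α : Icc (0:ℝ) 1 => suppFn A u α :=
    Antitone.measurable fun α β h => A.suppFn_le_suppFn u α.2.1 h β.2.2
  have hX : Measurable fun p : Icc (0:ℝ) 1 × Ω => suppFn (𝒳 p.2) u p.1 :=
    hjoint.comp (measurable_const.prodMk measurable_id :
      Measurable fun p : Icc (0:ℝ) 1 × Ω => ((⟨u, hu⟩ : ({-1, 1} : Set ℝ)), p))
  refine (((integrable_const (sSup ((fun x => |x|) '' fuzzyLevel A.mem 0))).add
    (hL1.comp_snd (volume : Measure (Icc (0:ℝ) 1))))).mono'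
    ((hA.comp measurable_fst).sub hX).abs.aestronglyMeasurable (.of_forall fun p => ?_)
  rw [Real.norm_eq_abs, abs_abs]
  exact (abs_sub _ _).trans
    (add_le_add (A.abs_suppFn_le hu p.1.2) ((𝒳 p.2).abs_suppFn_le hu p.1.2))

/-- The integrand of the `L¹`-distance to `𝒳` after exchanging the order of integration. -/
def meanAbsDev (P : Measure Ω) (𝒳 : Ω → FuzzyNumber) (A : FuzzyNumber) (u α : ℝ) : ℝ :=
  ∫ ω, |suppFn A u α - suppFn (𝒳 ω) u α| ∂P

theorem integrable_meanAbsDev (hjoint : JointlyMeasurable 𝒳) (hL1 : FuzzyL1 P 𝒳)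
    (A : FuzzyNumber) {u : ℝ} (hu : u ∈ ({-1, 1} : Set ℝ)) :
    Integrable (fun α : Icc (0:ℝ) 1 => meanAbsDev P 𝒳 A u α) :=
  (integrable_prod_abs_suppFn_sub hjoint hL1 A hu).integral_prod_left

theorem integral_rho1 (hjoint : JointlyMeasurable 𝒳) (hL1 : FuzzyL1 P 𝒳) (A : FuzzyNumber) :
    ∫ ω, rho1 A (𝒳 ω) ∂P =
      (1/2) * ∫ α : Icc (0:ℝ) 1, (meanAbsDev P 𝒳 A 1 α + meanAbsDev P 𝒳 A (-1) α) := by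
  have h1 := integrable_prod_abs_suppFn_sub hjoint hL1 A (u := 1) (by simp)
  have h2 := integrable_prod_abs_suppFn_sub hjoint hL1 A (u := -1) (by simp)
  have hrho : ∀ B, rho1 A B = (1/2) * ∫ α : Icc (0:ℝ) 1,
      (|suppFn A 1 α - suppFn B 1 α| + |suppFn A (-1) α - suppFn B (-1) α|) := by
    intro B
    rw [rho1, intervalIntegral.integral_of_le zero_le_one, ← integral_Icc_eq_integral_Ioc,
      ← integral_subtype measurableSet_Icc]
  simp only [hrho]
  rw [integral_const_mul, ← integral_integral_swap (h1.add h2)]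
  congr 1
  refine integral_congr_ae ?_
  filter_upwards [h1.prod_right_ae, h2.prod_right_ae] with α h1α h2α
  exact integral_add h1α h2α

theorem forall_D1_le_iff (hmeas : SuppMeasurable 𝒳) (hjoint : JointlyMeasurable 𝒳)
    (hL1 : FuzzyL1 P 𝒳) :
    (∀ U : FuzzyNumber, D1 P 𝒳 U ≤ D1 P 𝒳 A) ↔ IsSupportMedian P 𝒳 A := by
  have h1 : (1:ℝ) ∈ ({-1, 1} : Set ℝ) := by simp
  have h2 : (-1:ℝ) ∈ ({-1, 1} : Set ℝ) := by simp
  have hle : ∀ {B : FuzzyNumber}, IsSupportMedian P 𝒳 B → ∀ U : FuzzyNumber,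
      ∀ u ∈ ({-1, 1} : Set ℝ), ∀ α ∈ Icc (0:ℝ) 1,
      meanAbsDev P 𝒳 B u α ≤ meanAbsDev P 𝒳 U u α ∧
        (meanAbsDev P 𝒳 U u α ≤ meanAbsDev P 𝒳 B u α →
          suppFn U u α ∈ MedSet P fun ω => suppFn (𝒳 ω) u α) :=
    fun hB U u hu α hα => integral_abs_sub_le_of_mem_medSet (hmeas u hu α hα)
      (integrable_suppFn hmeas hL1 hu hα) (hB u hu α hα) _
  have hint : ∀ U, Integrable fun α : Icc (0:ℝ) 1 =>
      meanAbsDev P 𝒳 U 1 α + meanAbsDev P 𝒳 U (-1) α := fun U =>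
    (integrable_meanAbsDev hjoint hL1 U h1).add (integrable_meanAbsDev hjoint hL1 U h2)
  simp only [D1_le_D1_iff, integral_rho1 hjoint hL1]
  constructor
  · intro h
    obtain ⟨B, hB⟩ := exists_isSupportMedian (P := P) hmeas
    have hmono : ∀ α : Icc (0:ℝ) 1, meanAbsDev P 𝒳 B 1 α + meanAbsDev P 𝒳 B (-1) α ≤
        meanAbsDev P 𝒳 A 1 α + meanAbsDev P 𝒳 A (-1) α := fun α =>
      add_le_add (hle hB A 1 h1 α α.2).1 (hle hB A (-1) h2 α α.2).1
    have heq := le_antisymm (integral_mono (hint B) (hint A) hmono) (by linarith [h B])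
    have hae := (integral_eq_iff_of_ae_le (hint B) (hint A) (.of_forall hmono)).1 heq
    have hae' : ∀ᵐ α : ℝ, α ∈ Icc (0:ℝ) 1 → meanAbsDev P 𝒳 B 1 α + meanAbsDev P 𝒳 B (-1) α =
        meanAbsDev P 𝒳 A 1 α + meanAbsDev P 𝒳 A (-1) α :=
      (ae_restrict_iff' measurableSet_Icc).1
        ((ae_restrict_iff_subtype measurableSet_Icc).2 hae)
    refine isSupportMedian_of_ae hmeas fun u hu => ?_
    filter_upwards [hae'] with α hα hα01
    refine (hle hB A u hu α hα01).2 ?_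
    have e1 := (hle hB A 1 h1 α hα01).1
    have e2 := (hle hB A (-1) h2 α hα01).1
    have := hα hα01
    rcases hu with rfl | rfl <;> linarith
  · intro hA U
    refine mul_le_mul_of_nonneg_left (integral_mono (hint A) (hint U) fun α => ?_) (by norm_num)
    exact add_le_add (hle hA U 1 h1 α α.2).1 (hle hA U (-1) h2 α α.2).1

end Depth

/-- For `𝒳 ∈ L¹`, a fuzzy number maximizes the depth `D₁(·;𝒳)` over `F_c(ℝ)` iff it
maximizes the fuzzy Tukey depth `D_FT(·;𝒳)` over `F_c(ℝ)`. -/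
theorem D1_median_iff_tukey_median
    {Ω : Type*} [MeasurableSpace Ω] (P : Measure Ω) [IsProbabilityMeasure P]
    (𝒳 : Ω → FuzzyNumber) (hmeas : SuppMeasurable 𝒳) (hjoint : JointlyMeasurable 𝒳)
    (hL1 : FuzzyL1 P 𝒳) (A : FuzzyNumber) :
    (∀ U : FuzzyNumber, D1 P 𝒳 U ≤ D1 P 𝒳 A) ↔
      (∀ U : FuzzyNumber, DFT P 𝒳 U ≤ DFT P 𝒳 A) := by
  rw [forall_D1_le_iff hmeas hjoint hL1, forall_DFT_le_iff hmeas]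

end
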